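/- arXiv:1205.5215 — 3 statements merged into one kernel-verified Lean document; each statement's English description precedes it below -/
import Mathlib

section
/- Simplification of Eynard's two-boundary constant: for all positive integers ℓ_1 ≥ ℓ_2 with ℓ_1 + ℓ_2 even, the following identity of rational numbers holds: Σ_{j=0}^{⌊ℓ_2/2⌋} (ℓ_2 − 2j) · ℓ_1!·ℓ_2! / ( j! · ((ℓ_1−ℓ_2)/2 + j)! · ((ℓ_1+ℓ_2)/2 − j)! · (ℓ_2 − j)! ) = (2/(ℓ_1+ℓ_2)) · α(ℓ_1) · α(ℓ_2). (This identifies the constant in Eynard's formula G_{ℓ_1,ℓ_2} = γ^{ℓ_1+ℓ_2}·Σ_j(…) with the constant α(ℓ_1)α(ℓ_2)/s, s = (ℓ_1+ℓ_2)/2, appearing in the main theorem.) -/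
/-- `α(ℓ) = ℓ!/(⌊ℓ/2⌋!·⌊(ℓ−1)/2⌋!)` as a rational number. -/
noncomputable def alphaBip (ℓ : ℕ) : ℚ :=
  (Nat.factorial ℓ : ℚ) /
    ((Nat.factorial (ℓ / 2) : ℚ) * (Nat.factorial ((ℓ - 1) / 2) : ℚ))

lemma eynard_partial (b d : ℕ) (F : ℚ) (n : ℕ) : ∀ k : ℕ, b = n + 1 + k →
    ∑ j ∈ Finset.range (n + 1),
      ((b : ℚ) - 2 * j) * F /
        ((Nat.factorial j : ℚ) * (Nat.factorial (d + j) : ℚ) *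
          (Nat.factorial (b + d - j) : ℚ) * (Nat.factorial (b - j) : ℚ)) =
      F / (((b + d : ℕ) : ℚ) * ((Nat.factorial n : ℚ) * (Nat.factorial (d + n) : ℚ) *
          (Nat.factorial (k + d) : ℚ) * (Nat.factorial k : ℚ))) := by
  induction n with
  | zero =>
    intro k hk
    subst hk
    have e1 : 0 + 1 + k + d - 0 = (k + d) + 1 := by omega
    have e2 : 0 + 1 + k - 0 = k + 1 := by omega
    rw [Finset.sum_range_one, e1, e2, Nat.factorial_succ, Nat.factorial_succ]
    have h1 := Nat.factorial_pos (k + d)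
    have h2 := Nat.factorial_pos k
    have h3 := Nat.factorial_pos d
    have h4 : (0 + 1 + k + d : ℚ) ≠ 0 := by positivity
    push_cast
    simp only [add_zero, Nat.factorial_zero]
    field_simp
    push_cast
    ring
  | succ n ih =>
    intro k hk
    rw [Finset.sum_range_succ, ih (k + 1) (by omega)]
    have e1 : b + d - (n + 1) = (k + d) + 1 := by omega
    have e2 : b - (n + 1) = k + 1 := by omega
    have e3 : k + 1 + d = (k + d) + 1 := by omega
    have e4 : d + (n + 1) = (d + n) + 1 := by omega
    rw [e1, e2, e3, e4]
    simp only [Nat.factorial_succ]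
    have h1 := Nat.factorial_pos (k + d)
    have h2 := Nat.factorial_pos k
    have h3 := Nat.factorial_pos (d + n)
    have h4 := Nat.factorial_pos n
    subst hk
    push_cast
    field_simp
    ring

/-- simplification of Eynard's two-boundary constant. For positive integers
`ℓ₁ ≥ ℓ₂` with `ℓ₁ + ℓ₂` even,
`Σ_{j=0}^{⌊ℓ₂/2⌋} (ℓ₂−2j)·ℓ₁!·ℓ₂!/(j!·((ℓ₁−ℓ₂)/2+j)!·((ℓ₁+ℓ₂)/2−j)!·(ℓ₂−j)!)
  = (2/(ℓ₁+ℓ₂))·α(ℓ₁)·α(ℓ₂)`. -/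
theorem stmt_7 (ℓ₁ ℓ₂ : ℕ) (h₂ : 1 ≤ ℓ₂) (h₁₂ : ℓ₂ ≤ ℓ₁) (heven : 2 ∣ ℓ₁ + ℓ₂) :
    ∑ j ∈ Finset.range (ℓ₂ / 2 + 1),
      ((ℓ₂ - 2 * j : ℕ) : ℚ) *
          ((Nat.factorial ℓ₁ : ℚ) * (Nat.factorial ℓ₂ : ℚ)) /
        ((Nat.factorial j : ℚ) * (Nat.factorial ((ℓ₁ - ℓ₂) / 2 + j) : ℚ) *
          (Nat.factorial ((ℓ₁ + ℓ₂) / 2 - j) : ℚ) * (Nat.factorial (ℓ₂ - j) : ℚ)) =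
      (2 / ((ℓ₁ + ℓ₂ : ℕ) : ℚ)) * alphaBip ℓ₁ * alphaBip ℓ₂ := by
  obtain ⟨d, rfl⟩ : ∃ d, ℓ₁ = ℓ₂ + 2 * d := ⟨(ℓ₁ - ℓ₂) / 2, by omega⟩
  have key := eynard_partial ℓ₂ d
    ((Nat.factorial (ℓ₂ + 2 * d) : ℚ) * (Nat.factorial ℓ₂ : ℚ)) (ℓ₂ / 2)
    ((ℓ₂ - 1) / 2) (by omega)
  have e1 : (ℓ₂ + 2 * d - ℓ₂) / 2 = d := by omega
  have e2 : (ℓ₂ + 2 * d + ℓ₂) / 2 = ℓ₂ + d := by omega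
  rw [e1, e2]
  have hs : ∀ j ∈ Finset.range (ℓ₂ / 2 + 1), ((ℓ₂ - 2 * j : ℕ) : ℚ) = (ℓ₂ : ℚ) - 2 * j := by
    intro j hj
    rw [Finset.mem_range] at hj
    rw [Nat.cast_sub (by omega)]
    push_cast
    ring
  rw [Finset.sum_congr rfl (fun j hj => by rw [hs j hj]), key]
  unfold alphaBip
  have e3 : (ℓ₂ + 2 * d) / 2 = d + ℓ₂ / 2 := by omega
  have e4 : (ℓ₂ + 2 * d - 1) / 2 = (ℓ₂ - 1) / 2 + d := by omega
  have e5 : ℓ₂ + 2 * d + ℓ₂ = 2 * (ℓ₂ + d) := by omega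
  rw [e3, e4, e5]
  have h1 := Nat.factorial_pos (d + ℓ₂ / 2)
  have h2 := Nat.factorial_pos ((ℓ₂ - 1) / 2 + d)
  have h3 := Nat.factorial_pos (ℓ₂ / 2)
  have h4 := Nat.factorial_pos ((ℓ₂ - 1) / 2)
  have h5 : 0 < ℓ₂ + d := by omega
  rw [Nat.cast_mul]
  generalize ℓ₂ + d = s at *
  field_simp
  try push_cast
  try ring
end

section
/- Integrality in Tutte's formula of slicings: let r ≥ 1 and let ℓ_1, …, ℓ_r be positive integers of which none or exactly two are odd; set e = (ℓ_1+⋯+ℓ_r)/2 and v = e − r + 2, and assume v ≥ 1. Then v! · Π_{i=1}^r ( ⌊ℓ_i/2⌋! · ⌊(ℓ_i−1)/2⌋! ) divides (e−1)! · Π_{i=1}^r ℓ_i! in the integers; equivalently, the rational number (e−1)!/v! · Π_{i=1}^r α(ℓ_i) is a positive integer. (This number equals the number A[ℓ_1,…,ℓ_r] of planar maps with r numbered faces of degrees ℓ_1,…,ℓ_r, each carrying a marked corner.) -/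
theorem aux_div (q : ℕ) : ∀ t p s : ℕ, p + t = q + s →
    (p + t) ∣ p * s * ((p + q).choose q * (s + t).choose t) := by
  induction q with
  | zero =>
    intro t p s h
    have : p + t = s := by omega
    rw [this]
    exact Dvd.dvd.mul_right (Dvd.intro_left p rfl) _
  | succ q ih =>
    intro t p s h
    cases t with
    | zero =>
      rw [Nat.add_zero, mul_assoc]
      exact Dvd.intro _ rfl
    | succ t =>
      have h1 := ih t (p + 1) (s + 1) (by omega)
      have e1 : (p + (q + 1)).choose (q + 1) * (q + 1) = (p + 1 + q).choose q * (p + 1) := by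
        have := Nat.choose_succ_right_eq (p + 1 + q) q
        rw [show p + 1 + q - q = p + 1 by omega] at this
        rw [show p + (q + 1) = p + 1 + q by omega]
        exact this
      have e2 : (s + (t + 1)).choose (t + 1) * (t + 1) = (s + 1 + t).choose t * (s + 1) := by
        have := Nat.choose_succ_right_eq (s + 1 + t) t
        rw [show s + 1 + t - t = s + 1 by omega] at this
        rw [show s + (t + 1) = s + 1 + t by omega]
        exact this
      rw [← Int.natCast_dvd_natCast] at h1 ⊢
      obtain ⟨k, hk⟩ := h1
      zify at e1 e2 h
      push_cast at hk e1 e2 h ⊢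
      generalize (((p + (q + 1)).choose (q + 1) : ℕ) : ℤ) = A at *
      generalize (((s + (t + 1)).choose (t + 1) : ℕ) : ℤ) = B at *
      generalize (((p + 1 + q).choose q : ℕ) : ℤ) = C at *
      generalize (((s + 1 + t).choose t : ℕ) : ℤ) = D at *
      have hs : (s : ℤ) = p + (t + 1) - (q + 1) := by linarith
      have hk2 : A * (q + 1) * (B * (t + 1)) = (p + 1 + t) * k := by
        rw [e1, e2, ← hk]; ring
      refine ⟨k + (p - (q + 1)) * (A * B), ?_⟩
      rw [hs]
      linear_combination hk2

theorem aux_alpha (l : ℕ) (hl : 1 ≤ l) :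
    l.factorial = ((l - l / 2) * (l - l / 2 + l / 2).choose (l / 2)) *
      ((l / 2).factorial * ((l - 1) / 2).factorial) := by
  have h := Nat.choose_mul_factorial_mul_factorial (n := l) (k := l / 2) (by omega)
  rw [show l - l / 2 + l / 2 = l by omega]
  have h2 : (l - l / 2).factorial = (l - l / 2) * ((l - 1) / 2).factorial := by
    rw [show (l - 1) / 2 = (l - l / 2) - 1 by omega]
    exact (Nat.mul_factorial_pred (by omega)).symm
  rw [h2] at h
  rw [← h]; ring

/-- integrality in Tutte's formula of slicings. Let `r ≥ 1` and let
`ℓ_1,…,ℓ_r` be positive integers of which none or exactly two are odd; let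
`e = (ℓ_1+⋯+ℓ_r)/2` (stated as `2e = Σℓ_i`) and `v = e − r + 2` (stated as
`v + r = e + 2`) with `v ≥ 1`. Then
`v!·Π_i(⌊ℓ_i/2⌋!·⌊(ℓ_i−1)/2⌋!)` divides `(e−1)!·Π_i ℓ_i!`. -/
theorem stmt_8 (r : ℕ) (hr : 1 ≤ r) (ℓ : Fin r → ℕ) (hℓ : ∀ i, 1 ≤ ℓ i)
    (hodd : (Finset.univ.filter fun i => Odd (ℓ i)).card = 0 ∨
            (Finset.univ.filter fun i => Odd (ℓ i)).card = 2)
    (e : ℕ) (he : 2 * e = ∑ i : Fin r, ℓ i)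
    (v : ℕ) (hv : v + r = e + 2) (hv1 : 1 ≤ v) :
    (Nat.factorial v *
        ∏ i : Fin r, (Nat.factorial (ℓ i / 2) * Nat.factorial ((ℓ i - 1) / 2))) ∣
      (Nat.factorial (e - 1) * ∏ i : Fin r, Nat.factorial (ℓ i)) := by
  have hcases : r = 1 ∨ r = 2 ∨ 3 ≤ r := by omega
  rcases hcases with rfl | rfl | h3
  · have hl := hℓ 0
    simp only [Fin.sum_univ_one, Fin.prod_univ_one] at *
    obtain ⟨n, rfl⟩ : ∃ n, e = n + 1 := ⟨e - 1, by omega⟩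
    obtain rfl : v = n + 2 := by omega
    rw [← he, show 2 * (n + 1) / 2 = n + 1 by omega, show (2 * (n + 1) - 1) / 2 = n by omega,
      show n + 1 - 1 = n by omega]
    have h1 := succ_mul_catalan_eq_centralBinom (n + 1)
    have h2 := Nat.choose_mul_factorial_mul_factorial (n := 2 * (n + 1)) (k := n + 1) (by omega)
    rw [show 2 * (n + 1) - (n + 1) = n + 1 by omega, ← Nat.centralBinom_eq_two_mul_choose,
      ← h1] at h2
    refine ⟨catalan (n + 1), ?_⟩
    rw [← h2, Nat.factorial_succ (n + 1)]
    ring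
  · have h0 := hℓ 0
    have h1 := hℓ 1
    simp only [Fin.sum_univ_two, Fin.prod_univ_two] at *
    obtain rfl : v = e := by omega
    have hd := aux_div (ℓ 0 / 2) (ℓ 1 / 2) (ℓ 0 - ℓ 0 / 2) (ℓ 1 - ℓ 1 / 2) (by omega)
    rw [show ℓ 0 - ℓ 0 / 2 + ℓ 1 / 2 = v by omega] at hd
    obtain ⟨k, hk⟩ := hd
    rw [aux_alpha _ h0, aux_alpha _ h1, ← Nat.mul_factorial_pred (n := v) (by omega)]
    refine ⟨k, ?_⟩
    generalize (ℓ 0 - ℓ 0 / 2 + ℓ 0 / 2).choose (ℓ 0 / 2) = A at *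
    generalize (ℓ 1 - ℓ 1 / 2 + ℓ 1 / 2).choose (ℓ 1 / 2) = B at *
    generalize ℓ 0 - ℓ 0 / 2 = p at *
    generalize ℓ 1 - ℓ 1 / 2 = s at *
    generalize (ℓ 0 / 2).factorial = x1 at *
    generalize (ℓ 1 / 2).factorial = x2 at *
    generalize ((ℓ 0 - 1) / 2).factorial = x3 at *
    generalize ((ℓ 1 - 1) / 2).factorial = x4 at *
    linear_combination ((v - 1).factorial * x1 * x2 * x3 * x4) * hk
  · apply mul_dvd_mul
    · exact Nat.factorial_dvd_factorial (by omega)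
    · apply Finset.prod_dvd_prod_of_dvd
      intro i _
      exact ⟨_, (aux_alpha _ (hℓ i)).trans (mul_comm _ _)⟩
end

section
/- Integrality in the slicings-type formula for p-hypermaps: let p ≥ 2, r ≥ 1, and let ℓ_1, …, ℓ_r be positive integers with ε = ℓ_1+⋯+ℓ_r divisible by p, of which none or exactly two are not divisible by p; set d = ε/p and v = ε − d − r + 2, and assume v ≥ 1. Set c = 1 if every ℓ_i is divisible by p and c = p−1 if exactly two are not. Then v! · Π_{i=1}^r ( ⌊ℓ_i/p⌋! · (ℓ_i − ⌊ℓ_i/p⌋ − 1)! ) divides c · (ε−d−1)! · Π_{i=1}^r ℓ_i! in the integers; equivalently, the rational number c·(ε−d−1)!/v! · Π_{i=1}^r α_p(ℓ_i) is a positive integer. (This number equals the number A^{(p)}[ℓ_1,…,ℓ_r] of p-hypermaps with r numbered light faces of degrees ℓ_1,…,ℓ_r, each carrying a marked corner.) -/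
/-- Telescoping divisibility: the key fact for two faces. -/
lemma key_dvd (a b p d : ℕ) (h : a + b = p * d) (i : ℕ) : ∀ j : ℕ, i + j = d →
    d ∣ (i * a.choose i) * ((j + 1) * b.choose (j + 1)) := by
  have step : ∀ n k : ℕ, (((k + 1) * n.choose (k + 1) : ℕ) : ℤ)
      = (n.choose k : ℤ) * ((n : ℤ) - k) := by
    intro n k
    have h1 := Nat.choose_succ_right_eq n k
    rcases le_or_gt k n with hk | hk
    · rw [mul_comm, h1]
      push_cast [Nat.cast_sub hk]
      ring
    · rw [Nat.choose_eq_zero_of_lt hk, Nat.choose_eq_zero_of_lt (by omega)]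
      simp
  induction i with
  | zero => intro j _; simp
  | succ i ih =>
    intro j hj
    have h1 := ih (j + 1) (by omega)
    rw [← Int.natCast_dvd_natCast] at h1 ⊢
    have e1 := step a i
    have e2 := step b (j + 1)
    have e : (((i + 1) * a.choose (i + 1) * ((j + 1) * b.choose (j + 1)) : ℕ) : ℤ)
        = ((i * a.choose i * ((j + 1 + 1) * b.choose (j + 1 + 1)) : ℕ) : ℤ)
          + (d : ℤ) * (a.choose i * b.choose (j + 1) * ((a : ℤ) - i * p)) := by
      rw [Nat.cast_mul, e1, Nat.cast_mul (i * a.choose i), e2]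
      have hh : (a : ℤ) + b = p * d := by exact_mod_cast h
      have hb : (b : ℤ) = p * d - a := by linarith
      have hd : (d : ℤ) = i + 1 + j := by exact_mod_cast hj.symm
      rw [hb, hd]
      push_cast
      ring
    rw [e]
    exact dvd_add h1 (dvd_mul_right _ _)

lemma alpha_eq (l m : ℕ) (h : m < l) :
    l.factorial = (m.factorial * (l - m - 1).factorial) * ((m + 1) * l.choose (m + 1)) := by
  have := Nat.choose_mul_factorial_mul_factorial (n := l) (k := m + 1) h
  rw [Nat.factorial_succ, show l - (m + 1) = l - m - 1 by omega] at this
  rw [← this]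
  ring

/-- The case of two faces. -/
lemma two_faces (p a b d c : ℕ) (hp : 2 ≤ p) (hd : p * d = a + b)
    (h : (p ∣ a ∧ p ∣ b ∧ c = 1) ∨ (¬ p ∣ a ∧ ¬ p ∣ b ∧ c = p - 1)) :
    (a + b - d) ∣ c * (((a / p + 1) * a.choose (a / p + 1)) *
      ((b / p + 1) * b.choose (b / p + 1))) := by
  have hn : a + b - d = (p - 1) * d := by rw [← hd, Nat.sub_mul, one_mul]
  rw [hn]
  rcases h with ⟨⟨x, hx⟩, ⟨y, hy⟩, rfl⟩ | ⟨h1, h2, rfl⟩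
  · have hxp : a / p = x := by rw [hx]; exact Nat.mul_div_cancel_left _ (by omega)
    have hyp : b / p = y := by rw [hy]; exact Nat.mul_div_cancel_left _ (by omega)
    have hxy : x + y = d := by
      have : p * d = p * (x + y) := by rw [hd, hx, hy]; ring
      exact (Nat.eq_of_mul_eq_mul_left (by omega) this).symm
    have hk := key_dvd a b p d hd.symm x y hxy
    rw [hxp, hyp, one_mul]
    have e : (x + 1) * a.choose (x + 1) = (p - 1) * (x * a.choose x) := by
      rw [mul_comm, Nat.choose_succ_right_eq, show a - x = (p - 1) * x by
        rw [hx, Nat.sub_mul, one_mul]]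
      ring
    rw [e, mul_assoc (p - 1)]
    exact mul_dvd_mul_left _ hk
  · apply mul_dvd_mul_left
    apply key_dvd a b p d hd.symm
    have ha := Nat.div_add_mod a p
    have hb := Nat.div_add_mod b p
    have ha1 := Nat.mod_lt a (show p > 0 by omega)
    have hb1 := Nat.mod_lt b (show p > 0 by omega)
    have ha0 : 0 < a % p := Nat.pos_of_ne_zero fun h => h1 (Nat.dvd_of_mod_eq_zero h)
    have e : p * d = p * (a / p + b / p) + (a % p + b % p) := by rw [mul_add]; omega
    have l1 : a / p + b / p < d := by
      by_contra hh
      have := Nat.mul_le_mul_left p (not_lt.mp hh)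
      omega
    have l2 : d < a / p + b / p + 2 := by
      by_contra hh
      have := Nat.mul_le_mul_left p (not_lt.mp hh)
      rw [mul_add p _ 2] at this
      omega
    omega

/-- The case of one face. -/
lemma one_face (p d : ℕ) :
    (p * d - d + 1) * (p * d - d) ∣ (d + 1) * (p * d).choose (d + 1) := by
  rcases Nat.eq_zero_or_pos p with rfl | hp
  · simp
  rw [mul_comm (d + 1), Nat.choose_succ_right_eq]
  apply mul_dvd_mul_right
  have hle : d ≤ p * d := Nat.le_mul_of_pos_left d hp
  have h1 := Nat.choose_succ_right_eq (p * d) (p * d - d)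
  rw [Nat.choose_symm hle, Nat.sub_sub_self hle] at h1
  have hco : Nat.Coprime (p * d - d + 1) d := by
    rw [show p * d - d = (p - 1) * d by rw [Nat.sub_mul, one_mul]]
    simp
  exact hco.dvd_of_dvd_mul_right (h1 ▸ dvd_mul_left _ _)

/-- integrality in the slicings-type formula for `p`-hypermaps. Let `p ≥ 2`,
`r ≥ 1`, and let `ℓ_1,…,ℓ_r` be positive integers with `ε = ℓ_1+⋯+ℓ_r` divisible by `p`,
of which none or exactly two are not divisible by `p`; let `d = ε/p` (stated as
`p·d = ε`) and `v = ε − d − r + 2` (stated as `v + r = ε − d + 2`) with `v ≥ 1`; let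
`c = 1` if every `ℓ_i` is divisible by `p` and `c = p−1` if exactly two are not. Then
`v!·Π_i(⌊ℓ_i/p⌋!·(ℓ_i−⌊ℓ_i/p⌋−1)!)` divides `c·(ε−d−1)!·Π_i ℓ_i!`. -/
theorem stmt_9 (p : ℕ) (hp : 2 ≤ p) (r : ℕ) (hr : 1 ≤ r)
    (ℓ : Fin r → ℕ) (hℓ : ∀ i, 1 ≤ ℓ i)
    (ε : ℕ) (hε : ε = ∑ i : Fin r, ℓ i)
    (hnd : (Finset.univ.filter fun i => ¬ p ∣ ℓ i).card = 0 ∨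
           (Finset.univ.filter fun i => ¬ p ∣ ℓ i).card = 2)
    (d : ℕ) (hd : p * d = ε)
    (v : ℕ) (hv : v + r = ε - d + 2) (hv1 : 1 ≤ v)
    (c : ℕ)
    (hc : c = if (Finset.univ.filter fun i => ¬ p ∣ ℓ i).card = 0 then 1 else p - 1) :
    (Nat.factorial v *
        ∏ i : Fin r, (Nat.factorial (ℓ i / p) * Nat.factorial (ℓ i - ℓ i / p - 1))) ∣
      (c * Nat.factorial (ε - d - 1) * ∏ i : Fin r, Nat.factorial (ℓ i)) := by
  have hlt : ∀ i, ℓ i / p < ℓ i := fun i => Nat.div_lt_self (hℓ i) (by omega)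
  have hprod : ∏ i : Fin r, Nat.factorial (ℓ i) =
      (∏ i : Fin r, (Nat.factorial (ℓ i / p) * Nat.factorial (ℓ i - ℓ i / p - 1))) *
        ∏ i : Fin r, ((ℓ i / p + 1) * (ℓ i).choose (ℓ i / p + 1)) := by
    rw [← Finset.prod_mul_distrib]
    exact Finset.prod_congr rfl fun i _ => alpha_eq _ _ (hlt i)
  rw [hprod]
  suffices hs : Nat.factorial v ∣ c * Nat.factorial (ε - d - 1) *
      ∏ i : Fin r, ((ℓ i / p + 1) * (ℓ i).choose (ℓ i / p + 1)) by
    obtain ⟨k, hk⟩ := hs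
    refine ⟨k, ?_⟩
    rw [mul_left_comm, hk]
    ring
  have hεpos : 0 < ε := by
    rw [hε]
    exact Finset.sum_pos (fun i _ => hℓ i) ⟨⟨0, hr⟩, Finset.mem_univ _⟩
  have hdε : d < ε := by
    have : 0 < d := Nat.pos_of_ne_zero fun h => by rw [h] at hd; omega
    have := Nat.mul_le_mul_right d hp
    omega
  obtain h3 | rfl | rfl : 3 ≤ r ∨ r = 1 ∨ r = 2 := by omega
  · exact ((Nat.factorial_dvd_factorial (by omega)).mul_left c).mul_right _
  · have hcard : (Finset.univ.filter fun i => ¬ p ∣ ℓ i).card = 0 := by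
      have := Finset.card_le_univ (Finset.univ.filter fun i => ¬ p ∣ ℓ i)
      simp only [Fintype.card_fin] at this
      omega
    rw [if_pos hcard] at hc
    have hl : ℓ 0 = p * d := by rw [hd, hε]; simp
    have hlp : p * d / p = d := Nat.mul_div_cancel_left _ (by omega)
    obtain ⟨n, hn⟩ : ∃ n, ε - d = n + 1 := ⟨ε - d - 1, by omega⟩
    have h1 := one_face p d
    rw [hd, hn] at h1
    rw [Fin.prod_univ_one, hl, hlp, hd, hc, hn, show v = n + 1 + 1 by omega,
      Nat.factorial_succ, Nat.factorial_succ, one_mul, ← mul_assoc, mul_comm]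
    exact mul_dvd_mul_left _ h1
  · have h2 := two_faces p (ℓ 0) (ℓ 1) d c hp (by rw [hd, hε, Fin.sum_univ_two]) (by
      rcases hnd with h0 | h0
      · left
        rw [if_pos h0] at hc
        rw [Finset.card_eq_zero, Finset.filter_eq_empty_iff] at h0
        exact ⟨not_not.mp (h0 (Finset.mem_univ 0)), not_not.mp (h0 (Finset.mem_univ 1)), hc⟩
      · right
        rw [if_neg (by omega)] at hc
        have hu := (Finset.card_eq_iff_eq_univ _).mp (h0.trans (Fintype.card_fin 2).symm)
        rw [Finset.filter_eq_self] at hu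
        exact ⟨hu 0 (Finset.mem_univ 0), hu 1 (Finset.mem_univ 1), hc⟩)
    rw [← Fin.sum_univ_two, ← hε] at h2
    obtain ⟨n, hn⟩ : ∃ n, ε - d = n + 1 := ⟨ε - d - 1, by omega⟩
    rw [hn] at h2
    rw [Fin.prod_univ_two, hn, show v = n + 1 by omega, Nat.factorial_succ, Nat.add_sub_cancel,
      mul_right_comm]
    exact mul_dvd_mul_right h2 _
end
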